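/- Let real parameters (α, δ, μ, σ, η, λ, ξ, ζ) satisfy η ≥ 0, ξ ≥ 0, ζ ≥ 0, λ ≤ 0, 2α + 4πδ + μ − 4ζ ≥ 0, 2α + σ − 2η − 4ζ ≥ 0, and D := 6πα − πμ + 4πσ + 24πη + 4λ + 4ξ − 12πζ > 0. Then h₁(K, S(K))² ≤ max{1, 3/(2D)} · W, where W = α∫₀^{2π}ρ(θ)²dθ + δL² + μA + σ|Ã| + η∫₀^{2π}ρ_β(θ)²dθ + λ(ρ_e − ρ_i)² + ξ(ρ_M − ρ_m)² + ζ∫₀^{2π}ρ(θ)⁻¹dθ. -/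

import Mathlib

open MeasureTheory

noncomputable section

lemma wirt_aux (k : ℝ) (f f' : ℝ → ℝ) (hf : ∀ x, HasDerivAt f (f' x) x) (hf' : Continuous f')
    (h0 : f 0 = f (2 * Real.pi)) (hpi : (0:ℝ) < 2 * Real.pi)
    (hk : ∀ n : ℤ, fourierCoeffOn hpi (fun x => (f x : ℂ)) n = 0 ∨ (n ≠ 0 ∧ k ^ 2 ≤ (n:ℝ) ^ 2)) :
    k ^ 2 * ∫ x in (0:ℝ)..(2 * Real.pi), f x ^ 2 ≤ ∫ x in (0:ℝ)..(2 * Real.pi), f' x ^ 2 := by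
  have hfc : Continuous f := continuous_iff_continuousAt.2 fun x => (hf x).continuousAt
  have mem : ∀ g : ℝ → ℝ, Continuous g →
      MemLp (fun x => (g x : ℂ)) 2 (volume.restrict (Set.Ioc 0 (2 * Real.pi))) := by
    intro g hg
    have : Continuous (fun x => (g x : ℂ)) := by fun_prop
    obtain ⟨C, hC⟩ := (isCompact_Icc (a := (0:ℝ)) (b := 2 * Real.pi)).exists_bound_of_continuousOn this.continuousOn
    refine MemLp.of_bound this.aestronglyMeasurable C ?_
    filter_upwards [ae_restrict_mem measurableSet_Ioc] with x hx
    exact hC x (Set.Ioc_subset_Icc_self hx)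
  have s1 := (hasSum_sq_fourierCoeffOn hpi (mem f hfc)).mul_left (k ^ 2)
  have s2 := hasSum_sq_fourierCoeffOn hpi (mem f' hf')
  have key := hasSum_le (fun n => ?_) s1 s2
  · simp only [Complex.norm_real, Real.norm_eq_abs, sq_abs, smul_eq_mul, sub_zero] at key
    have hi : 0 < (2 * Real.pi)⁻¹ := by positivity
    rw [mul_left_comm] at key
    exact le_of_mul_le_mul_left key hi
  · rcases hk n with h | ⟨hn, hkn⟩
    · rw [h]; simp; 
    · have e := fourierCoeffOn_of_hasDerivAt hpi hn (f := fun x => (f x : ℂ)) (f' := fun x => (f' x : ℂ))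
        (fun x _ => (hf x).ofReal_comp) ((by fun_prop : Continuous (fun x => (f' x : ℂ))).intervalIntegrable _ _)
      have hn' : (n:ℂ) ≠ 0 := by exact_mod_cast hn
      have hp' : (Real.pi:ℂ) ≠ 0 := by exact_mod_cast Real.pi_ne_zero
      have e2 : fourierCoeffOn hpi (fun x => (f' x : ℂ)) n = Complex.I * n * fourierCoeffOn hpi (fun x => (f x : ℂ)) n := by
        rw [e, h0]
        have := Complex.I_ne_zero
        push_cast
        field_simp
        ring_nf
      rw [e2, norm_mul, norm_mul, Complex.norm_I, Complex.norm_intCast, one_mul, mul_pow, sq_abs]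
      gcongr

lemma wirt1 (f f' : ℝ → ℝ) (hf : ∀ x, HasDerivAt f (f' x) x) (hf' : Continuous f')
    (h0 : f 0 = f (2 * Real.pi)) (hi : ∫ x in (0:ℝ)..(2 * Real.pi), f x = 0) :
    ∫ x in (0:ℝ)..(2 * Real.pi), f x ^ 2 ≤ ∫ x in (0:ℝ)..(2 * Real.pi), f' x ^ 2 := by
  have hpi : (0:ℝ) < 2 * Real.pi := by positivity
  have := wirt_aux 1 f f' hf hf' h0 hpi ?_
  · simpa using this
  · intro n
    by_cases hn : n = 0
    · left
      subst hn
      rw [fourierCoeffOn_eq_integral]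
      have : ∫ x in (0:ℝ)..(2 * Real.pi), (f x : ℂ) = 0 := by
        rw [intervalIntegral.integral_ofReal, hi]; simp
      simp [this]
    · right
      refine ⟨hn, ?_⟩
      have : (1:ℤ) ≤ n ^ 2 := by have := Int.one_le_abs hn; rw [← sq_abs]; nlinarith
      have : (1:ℝ) ≤ (n:ℝ) ^ 2 := by exact_mod_cast this
      simpa using this

lemma wirt2 (f f' : ℝ → ℝ) (hf : ∀ x, HasDerivAt f (f' x) x) (hf' : Continuous f')
    (h0 : f 0 = f (2 * Real.pi)) (hi : ∫ x in (0:ℝ)..(2 * Real.pi), f x = 0)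
    (hc : ∫ x in (0:ℝ)..(2 * Real.pi), f x * Real.cos x = 0)
    (hs : ∫ x in (0:ℝ)..(2 * Real.pi), f x * Real.sin x = 0) :
    4 * ∫ x in (0:ℝ)..(2 * Real.pi), f x ^ 2 ≤ ∫ x in (0:ℝ)..(2 * Real.pi), f' x ^ 2 := by
  have hpi : (0:ℝ) < 2 * Real.pi := by positivity
  have hfc : Continuous f := continuous_iff_continuousAt.2 fun x => (hf x).continuousAt
  have := wirt_aux 2 f f' hf hf' h0 hpi ?_
  · norm_num at this
    linarith
  · intro n
    have hpc : (Real.pi:ℂ) ≠ 0 := by exact_mod_cast Real.pi_ne_zero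
    have gen : ∀ s : ℝ, ∫ x in (0:ℝ)..(2 * Real.pi), ((f x * Real.cos x : ℝ) : ℂ) + Complex.I * s * ((f x * Real.sin x : ℝ) : ℂ) = 0 := by
      intro s
      rw [intervalIntegral.integral_add, intervalIntegral.integral_const_mul, intervalIntegral.integral_ofReal,
        intervalIntegral.integral_ofReal, hc, hs]
      · simp
      · exact Continuous.intervalIntegrable (by fun_prop) _ _
      · exact Continuous.intervalIntegrable (by fun_prop) _ _
    by_cases hn : n = 0
    · left
      subst hn
      rw [fourierCoeffOn_eq_integral]
      have : ∫ x in (0:ℝ)..(2 * Real.pi), (f x : ℂ) = 0 := by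
        rw [intervalIntegral.integral_ofReal, hi]; simp
      simp [this]
    by_cases hn1 : n = 1 ∨ n = -1
    · left
      rw [fourierCoeffOn_eq_integral]
      have : ∫ x in (0:ℝ)..(2 * Real.pi), (fourier (-n) (x : AddCircle (2 * Real.pi - 0))) • (f x : ℂ) = 0 := by
        rw [← gen (-n)]
        congr 1
        ext x
        rw [fourier_coe_apply]
        have : 2 * Real.pi * Complex.I * ((-n : ℤ):ℂ) * x / ((2 * Real.pi - 0 : ℝ) : ℂ) = ((-n * x : ℝ) : ℂ) * Complex.I := by
          push_cast
          field_simp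
          ring
        rw [this, Complex.exp_mul_I, ← Complex.ofReal_cos, ← Complex.ofReal_sin]
        rcases hn1 with rfl | rfl
        · simp
          ring
        · simp
          ring
      rw [this]; simp
    · right
      refine ⟨hn, ?_⟩
      push Not at hn1
      have h2 : 2 ≤ |n| := by
        rcases abs_cases n with h | h <;> omega
      have : (4:ℤ) ≤ n ^ 2 := by rw [← sq_abs]; nlinarith
      have : (4:ℝ) ≤ (n:ℝ) ^ 2 := by exact_mod_cast this
      norm_num
      exact this

/-- Wirtinger on a short interval. -/
lemma gap (a b : ℝ) (hab : a ≤ b) (hb : b - a ≤ Real.pi) (f f' : ℝ → ℝ)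
    (hf : ∀ x, HasDerivAt f (f' x) x) (hf' : Continuous f') (ha0 : f a = 0) (hb0 : f b = 0) :
    ∫ x in a..b, f x ^ 2 ≤ ∫ x in a..b, f' x ^ 2 := by
  have hfc : Continuous f := continuous_iff_continuousAt.2 fun x => (hf x).continuousAt
  have main : ∀ k : ℝ, 0 < k → k < 1 → k ^ 2 * ∫ x in a..b, f x ^ 2 ≤ ∫ x in a..b, f' x ^ 2 := by
    intro k hk0 hk1
    set m := (a + b) / 2 with hm
    have hcos : ∀ x ∈ Set.Icc a b, 0 < Real.cos (k * (x - m)) := by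
      intro x hx
      have h1 : |x - m| ≤ Real.pi / 2 := by
        rw [abs_le]; constructor <;> linarith [hx.1, hx.2]
      have hpi := Real.pi_pos
      have h2 : |k * (x - m)| < Real.pi / 2 := by
        rw [abs_mul, abs_of_pos hk0]
        nlinarith [abs_nonneg (x - m)]
      rw [abs_lt] at h2
      exact Real.cos_pos_of_mem_Ioo ⟨by linarith, h2.2⟩
    have hd : ∀ x ∈ Set.uIcc a b, HasDerivAt (fun x => k * (f x ^ 2 * Real.tan (k * (x - m))))
        (k * (2 * f x * f' x * Real.tan (k * (x - m)) + f x ^ 2 * (k * (1 + Real.tan (k * (x - m)) ^ 2)))) x := by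
      intro x hx
      rw [Set.uIcc_of_le hab] at hx
      have hc := (hcos x hx).ne'
      have h1 : HasDerivAt (fun x => k * (x - m)) k x := by
        simpa using ((hasDerivAt_id x).sub_const m).const_mul k
      have h2 := (Real.hasDerivAt_tan hc).comp x h1
      have h3 := (((hf x).pow 2).mul h2).const_mul k
      refine h3.congr_deriv ?_
      have : 1 / Real.cos (k * (x - m)) ^ 2 = 1 + Real.tan (k * (x - m)) ^ 2 := by
        rw [Real.tan_eq_sin_div_cos]; field_simp; rw [Real.cos_sq_add_sin_sq]
      simp only [Function.comp]
      rw [this]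
      simp only [Pi.pow_apply]
      push_cast
      ring
    have htc : ContinuousOn (fun x => Real.tan (k * (x - m))) (Set.uIcc a b) := by
      rw [Set.uIcc_of_le hab]
      intro x hx
      have := (Real.continuousAt_tan.2 (hcos x hx).ne')
      exact (ContinuousAt.comp (f := fun x => k * (x - m)) (g := Real.tan) this (by fun_prop)).continuousWithinAt
    have e := intervalIntegral.integral_eq_sub_of_hasDerivAt hd (ContinuousOn.intervalIntegrable (by
      have := hfc.continuousOn (s := Set.uIcc a b); have := hf'.continuousOn (s := Set.uIcc a b)
      fun_prop))
    rw [ha0, hb0] at e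
    simp only [ne_eq, OfNat.ofNat_ne_zero, not_false_eq_true, zero_pow, zero_mul, mul_zero, sub_zero] at e
    have nn : 0 ≤ ∫ x in a..b, (f' x + k * f x * Real.tan (k * (x - m))) ^ 2 :=
      intervalIntegral.integral_nonneg hab fun x _ => sq_nonneg _
    have e3 : ∫ x in a..b, (f' x + k * f x * Real.tan (k * (x - m))) ^ 2
        = ∫ x in a..b, ((f' x ^ 2 - k ^ 2 * f x ^ 2) + (k * (2 * f x * f' x * Real.tan (k * (x - m)) + f x ^ 2 * (k * (1 + Real.tan (k * (x - m)) ^ 2))))) := by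
      congr 1; ext x; ring
    rw [e3, intervalIntegral.integral_add, e, intervalIntegral.integral_sub, intervalIntegral.integral_const_mul] at nn
    · linarith
    · exact Continuous.intervalIntegrable (by fun_prop) _ _
    · exact Continuous.intervalIntegrable (by fun_prop) _ _
    · exact Continuous.intervalIntegrable (by fun_prop) _ _
    · exact ContinuousOn.intervalIntegrable (by
        have := hfc.continuousOn (s := Set.uIcc a b); have := hf'.continuousOn (s := Set.uIcc a b)
        fun_prop)
  have ht : Filter.Tendsto (fun k : ℝ => k ^ 2 * ∫ x in a..b, f x ^ 2) (nhdsWithin 1 (Set.Iio 1)) (nhds (1 ^ 2 * ∫ x in a..b, f x ^ 2)) :=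
    ((by fun_prop : Continuous (fun k : ℝ => k ^ 2 * ∫ x in a..b, f x ^ 2)).tendsto 1).mono_left nhdsWithin_le_nhds
  have := le_of_tendsto ht (b := ∫ x in a..b, f' x ^ 2) (by
    filter_upwards [Ioo_mem_nhdsLT (show (0:ℝ) < 1 by norm_num)] with k hk using main k hk.1 hk.2)
  simpa using this

lemma center (f : ℝ → ℝ) (hf : Continuous f) (hper : ∀ θ, f (θ + 2 * Real.pi) = f θ) :
    ∃ c d R : ℝ, (∀ θ, f θ - c * Real.cos θ - d * Real.sin θ ≤ R) ∧
      ∀ a : ℝ, ∃ z ∈ Set.Icc a (a + Real.pi), f z - c * Real.cos z - d * Real.sin z = R := by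
  have hpi := Real.pi_pos
  set F : ℝ × ℝ → ℝ → ℝ := fun v θ => f θ - v.1 * Real.cos θ - v.2 * Real.sin θ with hF
  have hFper : ∀ v, Function.Periodic (F v) (2 * Real.pi) := by
    intro v θ; simp [hF, hper]
  have hFc : ∀ v, Continuous (F v) := by intro v; simp only [hF]; fun_prop
  set M : ℝ × ℝ → ℝ := fun v => sSup (F v '' Set.Icc 0 (2 * Real.pi)) with hM
  have hMc : Continuous M := by
    refine IsCompact.continuous_sSup isCompact_Icc ?_
    simp only [Function.HasUncurry.uncurry, hF, id]
    fun_prop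
  have hne : (Set.Icc (0:ℝ) (2 * Real.pi)).Nonempty := ⟨0, by constructor <;> linarith⟩
  have hle : ∀ v θ, F v θ ≤ M v := by
    intro v θ
    obtain ⟨y, hy, e⟩ := (hFper v).exists_mem_Ico₀ (by linarith) θ
    rw [e]
    exact le_csSup (isCompact_Icc.image (hFc v)).bddAbove ⟨y, Set.Ico_subset_Icc_self hy, rfl⟩
  have hatt : ∀ v, ∃ θ, F v θ = M v := by
    intro v
    obtain ⟨x, _, hx, _⟩ := isCompact_Icc.exists_sSup_image_eq_and_ge hne (hFc v).continuousOn
    exact ⟨x, hx.symm⟩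
  obtain ⟨C, hC⟩ := (isCompact_Icc (a := (0:ℝ)) (b := 2 * Real.pi)).exists_bound_of_continuousOn hf.continuousOn
  have hC' : ∀ x ∈ Set.Icc 0 (2 * Real.pi), -C ≤ f x := fun x hx => (abs_le.1 (hC x hx)).1
  have hco : ∀ v, ‖v‖ - C ≤ M v := by
    intro v
    have h1 := hle v 0
    have h2 := hle v Real.pi
    have h3 := hle v (Real.pi / 2)
    have h4 := hle v (Real.pi / 2 + Real.pi)
    simp only [hF, Real.cos_zero, Real.sin_zero, Real.cos_pi, Real.sin_pi, Real.cos_pi_div_two,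
      Real.sin_pi_div_two, Real.cos_add_pi, Real.sin_add_pi] at h1 h2 h3 h4
    have g1 := hC' 0 ⟨by linarith, by linarith⟩
    have g2 := hC' Real.pi ⟨by linarith, by linarith⟩
    have g3 := hC' (Real.pi / 2) ⟨by linarith, by linarith⟩
    have g4 := hC' (Real.pi / 2 + Real.pi) ⟨by linarith, by linarith⟩
    have : ‖v‖ ≤ M v + C := by
      rw [Prod.norm_def, max_le_iff, Real.norm_eq_abs, Real.norm_eq_abs, abs_le, abs_le]
      refine ⟨⟨?_, ?_⟩, ?_, ?_⟩ <;> linarith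
    linarith
  have htend : Filter.Tendsto M (Filter.cocompact _) Filter.atTop := by
    refine Filter.tendsto_atTop_mono hco ?_
    exact Filter.tendsto_atTop_add_const_right _ (-C) (tendsto_norm_cocompact_atTop (E := ℝ × ℝ))
  obtain ⟨v, hv⟩ := hMc.exists_forall_le htend
  refine ⟨v.1, v.2, M v, hle v, ?_⟩
  intro a
  by_contra! hcon
  have hlt : ∀ z ∈ Set.Icc a (a + Real.pi), F v z < M v := fun z hz => lt_of_le_of_ne (hle v z) (hcon z hz)
  obtain ⟨z0, hz0, hmax⟩ := (isCompact_Icc (a := a) (b := a + Real.pi)).exists_isMaxOn ⟨a, by constructor <;> linarith⟩ (hFc v).continuousOn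
  set t := (M v - F v z0) / 2 with ht
  have ht0 : 0 < t := by have := hlt z0 hz0; simp only [ht]; linarith
  set w : ℝ × ℝ := (v.1 - t * Real.cos (a + Real.pi / 2), v.2 - t * Real.sin (a + Real.pi / 2)) with hw
  have hFw : ∀ θ, F w θ = F v θ + t * Real.cos (θ - (a + Real.pi / 2)) := by
    intro θ; simp only [hF, hw, Real.cos_sub]; ring
  obtain ⟨θ, hθ⟩ := hatt w
  obtain ⟨y, hy, e⟩ := (hFper w).exists_mem_Ico (by linarith) θ a
  have hvw := hv w
  rw [← hθ, e, hFw] at hvw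
  by_cases hya : y ≤ a + Real.pi
  · have : F v y ≤ F v z0 := hmax (show y ∈ Set.Icc a (a + Real.pi) from ⟨hy.1, hya⟩)
    have h1 := Real.cos_le_one (y - (a + Real.pi / 2))
    have : t * Real.cos (y - (a + Real.pi / 2)) ≤ t := by nlinarith
    linarith
  · push Not at hya
    have : Real.cos (y - (a + Real.pi / 2)) < 0 :=
      Real.cos_neg_of_pi_div_two_lt_of_lt (by linarith) (by linarith [hy.2])
    have := hle v y
    nlinarith

lemma shift_int (g : ℝ → ℝ) (hg : ∀ θ, g (θ + 2 * Real.pi) = g θ) (t : ℝ) :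
    ∫ x in t..(t + 2 * Real.pi), g x = ∫ x in (0:ℝ)..(2 * Real.pi), g x := by
  have : Function.Periodic g (2 * Real.pi) := hg
  simpa using this.intervalIntegral_add_eq t 0

lemma halfzero (f f' : ℝ → ℝ) (hf : ∀ x, HasDerivAt f (f' x) x) (hf' : Continuous f')
    (hper : ∀ θ, f (θ + 2 * Real.pi) = f θ) (hper' : ∀ θ, f' (θ + 2 * Real.pi) = f' θ)
    (hz : ∀ a : ℝ, ∃ z ∈ Set.Icc a (a + Real.pi), f z = 0) :
    ∫ x in (0:ℝ)..(2 * Real.pi), f x ^ 2 ≤ ∫ x in (0:ℝ)..(2 * Real.pi), f' x ^ 2 := by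
  have hpi := Real.pi_pos
  have hfc : Continuous f := continuous_iff_continuousAt.2 fun x => (hf x).continuousAt
  obtain ⟨z0, -, hz0⟩ := hz 0
  have hcl : IsClosed {x | f x = 0} := isClosed_eq hfc continuous_const
  obtain ⟨z1, ⟨hz1m, hz1⟩, hz1u⟩ := (isCompact_Icc.inter_right hcl : IsCompact (Set.Icc z0 (z0 + Real.pi) ∩ {x | f x = 0})).exists_isGreatest
    ⟨z0, ⟨by linarith, by linarith⟩, hz0⟩
  obtain ⟨z2', hz2', hz2'0⟩ := hz (z0 + Real.pi)
  obtain ⟨z2, ⟨hz2m, hz2⟩, hz2l⟩ := (isCompact_Icc.inter_right hcl : IsCompact (Set.Icc (z0 + Real.pi) (z0 + Real.pi + Real.pi) ∩ {x | f x = 0})).exists_isLeast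
    ⟨z2', hz2', hz2'0⟩
  have hg : z2 - z1 ≤ Real.pi := by
    by_contra! hcon
    obtain ⟨w, hw, hw0⟩ := hz ((z1 + z2 - Real.pi) / 2)
    have a1 : z1 < w := by linarith [hw.1]
    have a2 : w < z2 := by linarith [hw.2]
    rcases le_total w (z0 + Real.pi) with h | h
    · have := hz1u ⟨⟨by linarith [hz1m.1], h⟩, hw0⟩
      linarith
    · have := hz2l ⟨⟨h, by linarith [hz2m.2]⟩, hw0⟩
      linarith
  have g1 := gap z0 z1 hz1m.1 (by linarith [hz1m.2]) f f' hf hf' hz0 hz1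
  have g2 := gap z1 z2 (by linarith [hz1m.2, hz2m.1]) hg f f' hf hf' hz1 hz2
  have g3 := gap z2 (z0 + 2 * Real.pi) (by linarith [hz2m.2]) (by linarith [hz2m.1]) f f' hf hf' hz2 (by rw [hper, hz0])
  rw [← shift_int (fun x => f x ^ 2) (by intro θ; simp [hper]) z0,
    ← shift_int (fun x => f' x ^ 2) (by intro θ; simp [hper']) z0]
  have ii : ∀ a b, IntervalIntegrable (fun x => f x ^ 2) volume a b := fun a b => Continuous.intervalIntegrable (by fun_prop) _ _
  have ii' : ∀ a b, IntervalIntegrable (fun x => f' x ^ 2) volume a b := fun a b => Continuous.intervalIntegrable (by fun_prop) _ _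
  rw [← intervalIntegral.integral_add_adjacent_intervals (ii z0 z1) (ii z1 _),
    ← intervalIntegral.integral_add_adjacent_intervals (ii z1 z2) (ii z2 _),
    ← intervalIntegral.integral_add_adjacent_intervals (ii' z0 z1) (ii' z1 _),
    ← intervalIntegral.integral_add_adjacent_intervals (ii' z1 z2) (ii' z2 _)]
  linarith

lemma nogap (f f1 f2 : ℝ → ℝ) (hf : ∀ x, HasDerivAt f (f1 x) x) (hf1 : ∀ x, HasDerivAt f1 (f2 x) x)
    (hc : Continuous f2) (a b : ℝ) (hab : a < b) (hb : b - a ≤ Real.pi) (ha0 : f a = 0) (hb0 : f b = 0)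
    (hb1 : f1 b = 0) (hpos : ∀ x, 0 < f x + f2 x) : False := by
  have hfc : Continuous f := continuous_iff_continuousAt.2 fun x => (hf x).continuousAt
  have hd : ∀ x ∈ Set.uIcc a b, HasDerivAt (fun x => f1 x * Real.sin (x - a) - f x * Real.cos (x - a))
      ((f x + f2 x) * Real.sin (x - a)) x := by
    intro x _
    have h0 : HasDerivAt (fun x => x - a) 1 x := (hasDerivAt_id x).sub_const a
    refine (((hf1 x).mul h0.sin).sub ((hf x).mul h0.cos)).congr_deriv ?_
    ring
  have hcc : Continuous (fun x => (f x + f2 x) * Real.sin (x - a)) := by fun_prop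
  have e := intervalIntegral.integral_eq_sub_of_hasDerivAt hd (hcc.intervalIntegrable _ _)
  rw [hb1, hb0, ha0] at e
  have : 0 < ∫ x in a..b, (f x + f2 x) * Real.sin (x - a) := by
    refine intervalIntegral.intervalIntegral_pos_of_pos_on (hcc.intervalIntegrable _ _) ?_ hab
    intro x hx
    exact mul_pos (hpos x) (Real.sin_pos_of_pos_of_lt_pi (by linarith [hx.1]) (by linarith [hx.2]))
  simp at e
  linarith

lemma quad (p p1 p2 : ℝ → ℝ) (hp : ∀ x, HasDerivAt p (p1 x) x) (hp1 : ∀ x, HasDerivAt p1 (p2 x) x)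
    (hc : Continuous p2) (hper : ∀ θ, p (θ + 2 * Real.pi) = p θ) (hper1 : ∀ θ, p1 (θ + 2 * Real.pi) = p1 θ)
    (c d R : ℝ) :
    (∫ x in (0:ℝ)..(2 * Real.pi), (p x - c * Real.cos x - d * Real.sin x - R) ^ 2)
      - (∫ x in (0:ℝ)..(2 * Real.pi), (p1 x + c * Real.sin x - d * Real.cos x) ^ 2)
    = (∫ x in (0:ℝ)..(2 * Real.pi), (p x ^ 2 - p1 x ^ 2)) - 2 * R * (∫ x in (0:ℝ)..(2 * Real.pi), (p x + p2 x))
      + 2 * Real.pi * R ^ 2 := by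
  have hpc : Continuous p := continuous_iff_continuousAt.2 fun x => (hp x).continuousAt
  have hp1c : Continuous p1 := continuous_iff_continuousAt.2 fun x => (hp1 x).continuousAt
  have p0 : p (2 * Real.pi) = p 0 := by simpa using hper 0
  have p10 : p1 (2 * Real.pi) = p1 0 := by simpa using hper1 0
  set G : ℝ → ℝ := fun x => 2 * p x * (d * Real.cos x - c * Real.sin x)
    - (c * Real.cos x + d * Real.sin x) * (d * Real.cos x - c * Real.sin x)
    - 2 * R * (d * Real.cos x - c * Real.sin x) + 2 * R * p1 x with hG
  set G' : ℝ → ℝ := fun x => ((p x - c * Real.cos x - d * Real.sin x - R) ^ 2 - (p1 x + c * Real.sin x - d * Real.cos x) ^ 2)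
    - ((p x ^ 2 - p1 x ^ 2) - 2 * R * (p x + p2 x) + R ^ 2) with hG'
  have hd : ∀ x ∈ Set.uIcc 0 (2 * Real.pi), HasDerivAt G (G' x) x := by
    intro x _
    have hg : HasDerivAt (fun x => c * Real.cos x + d * Real.sin x) (c * (-Real.sin x) + d * Real.cos x) x :=
      ((Real.hasDerivAt_cos x).const_mul c).add ((Real.hasDerivAt_sin x).const_mul d)
    have hg1 : HasDerivAt (fun x => d * Real.cos x - c * Real.sin x) (d * (-Real.sin x) - c * Real.cos x) x :=
      ((Real.hasDerivAt_cos x).const_mul d).sub ((Real.hasDerivAt_sin x).const_mul c)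
    refine ((((((hp x).const_mul 2).mul hg1).sub (hg.mul hg1)).sub (hg1.const_mul (2 * R))).add ((hp1 x).const_mul (2 * R))).congr_deriv ?_
    simp only [hG']
    ring
  have e := intervalIntegral.integral_eq_sub_of_hasDerivAt hd (Continuous.intervalIntegrable (by fun_prop) _ _)
  have e0 : G (2 * Real.pi) - G 0 = 0 := by simp [hG, p0, p10]
  rw [e0] at e
  simp only [hG'] at e
  rw [intervalIntegral.integral_sub (Continuous.intervalIntegrable (by fun_prop) _ _) (Continuous.intervalIntegrable (by fun_prop) _ _),
    intervalIntegral.integral_sub (Continuous.intervalIntegrable (by fun_prop) _ _) (Continuous.intervalIntegrable (by fun_prop) _ _),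
    intervalIntegral.integral_add (Continuous.intervalIntegrable (by fun_prop) _ _) (Continuous.intervalIntegrable (by fun_prop) _ _),
    intervalIntegral.integral_sub (Continuous.intervalIntegrable (by fun_prop) _ _) (Continuous.intervalIntegrable (by fun_prop) _ _),
    intervalIntegral.integral_const_mul, intervalIntegral.integral_const] at e
  simp only [sub_zero, smul_eq_mul] at e
  linarith

lemma bonnesen (p p1 p2 : ℝ → ℝ) (hp : ∀ x, HasDerivAt p (p1 x) x) (hp1 : ∀ x, HasDerivAt p1 (p2 x) x)
    (hc : Continuous p2) (hper : ∀ θ, p (θ + 2 * Real.pi) = p θ) (hper1 : ∀ θ, p1 (θ + 2 * Real.pi) = p1 θ)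
    (hpos : ∀ x, 0 < p x + p2 x) (L I : ℝ) (hL : L = ∫ x in (0:ℝ)..(2 * Real.pi), (p x + p2 x))
    (hI : I = ∫ x in (0:ℝ)..(2 * Real.pi), (p x ^ 2 - p1 x ^ 2)) :
    ∃ c d R c' d' r : ℝ, (∀ θ, p θ - c * Real.cos θ - d * Real.sin θ ≤ R) ∧
      (∀ θ, r ≤ p θ - c' * Real.cos θ - d' * Real.sin θ) ∧ 0 ≤ r ∧
      Real.pi ^ 2 * (R - r) ^ 2 ≤ L ^ 2 - 2 * Real.pi * I := by
  have hpi := Real.pi_pos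
  have hpc : Continuous p := continuous_iff_continuousAt.2 fun x => (hp x).continuousAt
  have hp1c : Continuous p1 := continuous_iff_continuousAt.2 fun x => (hp1 x).continuousAt
  have hd : ∀ c d R x, HasDerivAt (fun x => p x - c * Real.cos x - d * Real.sin x - R) (p1 x + c * Real.sin x - d * Real.cos x) x := by
    intro c d R x
    refine ((((hp x).sub ((Real.hasDerivAt_cos x).const_mul c)).sub ((Real.hasDerivAt_sin x).const_mul d)).sub_const R).congr_deriv ?_
    ring
  have hd1 : ∀ c d x, HasDerivAt (fun x => p1 x + c * Real.sin x - d * Real.cos x) (p2 x + c * Real.cos x + d * Real.sin x) x := by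
    intro c d x
    refine (((hp1 x).add ((Real.hasDerivAt_sin x).const_mul c)).sub ((Real.hasDerivAt_cos x).const_mul d)).congr_deriv ?_
    ring
  have key : ∀ c d R, (∀ a : ℝ, ∃ z ∈ Set.Icc a (a + Real.pi), p z - c * Real.cos z - d * Real.sin z = R) →
      I - 2 * R * L + 2 * Real.pi * R ^ 2 ≤ 0 := by
    intro c d R hz
    rw [hI, hL, ← quad p p1 p2 hp hp1 hc hper hper1 c d R]
    have := halfzero _ _ (hd c d R) (by fun_prop) (by intro θ; simp [hper]) (by intro θ; simp [hper1]) (by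
      intro a
      obtain ⟨z, hz, e⟩ := hz a
      exact ⟨z, hz, by linarith⟩)
    linarith
  obtain ⟨c, d, R, hR, hRz⟩ := center p hpc hper
  obtain ⟨c', d', r, hr, hrz⟩ := center (fun x => - p x) (by fun_prop) (by simp [hper])
  have hrz' : ∀ a : ℝ, ∃ z ∈ Set.Icc a (a + Real.pi), p z - (-c') * Real.cos z - (-d') * Real.sin z = -r := by
    intro a
    obtain ⟨z, hz, e⟩ := hrz a
    exact ⟨z, hz, by linarith⟩
  have hr' : ∀ θ, -r ≤ p θ - (-c') * Real.cos θ - (-d') * Real.sin θ := by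
    intro θ; linarith [hr θ]
  refine ⟨c, d, R, -c', -d', -r, hR, hr', ?_, ?_⟩
  · by_contra! hneg
    set f : ℝ → ℝ := fun x => p x - (-c') * Real.cos x - (-d') * Real.sin x - (-r) with hf
    have hf0 : ∀ x, 0 ≤ f x := fun x => by simp only [hf]; linarith [hr' x]
    have hcrit : ∀ z, f z = 0 → p1 z + (-c') * Real.sin z - (-d') * Real.cos z = 0 := by
      intro z hz
      have hm : IsLocalMin f z := Filter.Eventually.of_forall fun x => by rw [hz]; exact hf0 x
      exact hm.hasDerivAt_eq_zero (hd (-c') (-d') (-r) z)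
    have hps : ∀ x, 0 < f x + (p2 x + (-c') * Real.cos x + (-d') * Real.sin x) := by
      intro x; have := hpos x; simp only [hf]; linarith
    obtain ⟨z0, -, e0⟩ := hrz' 0
    have e0' : f z0 = 0 := by simp only [hf]; linarith
    obtain ⟨z, hz, e⟩ := hrz' (z0 + Real.pi / 2)
    have e' : f z = 0 := by simp only [hf]; linarith
    rcases le_total z (z0 + Real.pi) with h | h
    · exact nogap _ _ _ (hd (-c') (-d') (-r)) (hd1 (-c') (-d')) (by fun_prop) z0 z (by linarith [hz.1]) (by linarith) e0' e' (hcrit z e') hps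
    · have e2 : f (z0 + 2 * Real.pi) = 0 := by rw [← e0']; simp [hf, hper]
      exact nogap _ _ _ (hd (-c') (-d') (-r)) (hd1 (-c') (-d')) (by fun_prop) z (z0 + 2 * Real.pi) (by linarith [hz.2]) (by linarith) e' e2 (hcrit _ e2) hps
  · have k1 := key c d R hRz
    have k2 := key (-c') (-d') (-r) hrz'
    have h1 : (2 * Real.pi * R - L) ^ 2 ≤ L ^ 2 - 2 * Real.pi * I := by nlinarith
    have h2 : (2 * Real.pi * (-r) - L) ^ 2 ≤ L ^ 2 - 2 * Real.pi * I := by nlinarith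
    nlinarith [sq_nonneg ((2 * Real.pi * R - L) + (2 * Real.pi * (-r) - L))]

lemma pt0 (r r1 : ℝ → ℝ) (hr : ∀ x, HasDerivAt r (r1 x) x) (hc : Continuous r1)
    (h0 : r (2 * Real.pi) = r 0) (hi : ∫ x in (0:ℝ)..(2 * Real.pi), r x = 0)
    (hcs : ∫ x in (0:ℝ)..(2 * Real.pi), r x * Real.cos x = 0) :
    4 * Real.pi * r 0 ^ 2 ≤ 3 * ((∫ x in (0:ℝ)..(2 * Real.pi), r1 x ^ 2) - ∫ x in (0:ℝ)..(2 * Real.pi), r x ^ 2) := by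
  have hrc : Continuous r := continuous_iff_continuousAt.2 fun x => (hr x).continuousAt
  set K : ℝ → ℝ := fun x => 1 / 2 + Real.cos x / 4 - (Real.pi - x) / 2 * Real.sin x with hK
  set K1 : ℝ → ℝ := fun x => Real.sin x / 4 - (Real.pi - x) / 2 * Real.cos x with hK1
  have hKc : Continuous K := by fun_prop
  have hK1c : Continuous K1 := by fun_prop
  have hl : ∀ x, HasDerivAt (fun x => (Real.pi - x) / 2) (-1 / 2) x := fun x =>
    ((hasDerivAt_id x).const_sub Real.pi).div_const 2
  have hKd : ∀ x, HasDerivAt K (K1 x) x := by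
    intro x
    refine ((((Real.hasDerivAt_cos x).div_const 4).const_add (1/2)).sub ((hl x).mul (Real.hasDerivAt_sin x))).congr_deriv ?_
    simp only [hK1]; ring
  have hK1d : ∀ x, HasDerivAt K1 (1 / 2 + Real.cos x - K x) x := by
    intro x
    refine (((Real.hasDerivAt_sin x).div_const 4).sub ((hl x).mul (Real.hasDerivAt_cos x))).congr_deriv ?_
    simp only [hK]; ring
  have K0 : K 0 = 3 / 4 := by simp [hK]; norm_num
  have K2 : K (2 * Real.pi) = 3 / 4 := by simp [hK]; norm_num
  have K10 : K1 0 = - Real.pi / 2 := by simp [hK1]; ring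
  have K12 : K1 (2 * Real.pi) = Real.pi / 2 := by simp [hK1]; ring
  have iK : ∫ x in (0:ℝ)..(2 * Real.pi), K x = 0 := by
    rw [intervalIntegral.integral_eq_sub_of_hasDerivAt (f := fun x => x / 2 + Real.sin x - K1 x) (fun x _ => ?_) (hKc.intervalIntegrable _ _)]
    · rw [K10, K12]; simp; ring
    · refine ((((hasDerivAt_id x).div_const 2).add (Real.hasDerivAt_sin x)).sub (hK1d x)).congr_deriv ?_
      ring
  have iKK : ∫ x in (0:ℝ)..(2 * Real.pi), (K1 x ^ 2 - K x ^ 2) = 3 * Real.pi / 4 := by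
    rw [intervalIntegral.integral_eq_sub_of_hasDerivAt (f := fun x => K x * K1 x - (x / 2 + Real.sin x - K1 x) / 2
      - (Real.sin x / 2 + Real.sin x * Real.cos x / 4 - (Real.pi - x) / 2 * (Real.sin x * Real.sin x) / 2)) (fun x _ => ?_) (Continuous.intervalIntegrable (by fun_prop) _ _)]
    · rw [K10, K12, K0, K2]; simp; ring
    · have hs := Real.hasDerivAt_sin x
      have hco := Real.hasDerivAt_cos x
      refine ((((hKd x).mul (hK1d x)).sub (((((hasDerivAt_id x).div_const 2).add hs).sub (hK1d x)).div_const 2)).sub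
        (((hs.div_const 2).add ((hs.mul hco).div_const 4)).sub (((hl x).mul (hs.mul hs)).div_const 2))).congr_deriv ?_
      simp only [hK, hK1, Pi.mul_apply]
      ring
  have irK : ∫ x in (0:ℝ)..(2 * Real.pi), (r1 x * K1 x - r x * K x) = Real.pi * r 0 := by
    have e := intervalIntegral.integral_eq_sub_of_hasDerivAt (a := 0) (b := 2 * Real.pi) (f := fun x => r x * K1 x) (fun x _ => (hr x).mul (hK1d x))
      (Continuous.intervalIntegrable (by fun_prop) _ _)
    have e2 : ∫ x in (0:ℝ)..(2 * Real.pi), (r1 x * K1 x + r x * (1 / 2 + Real.cos x - K x))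
       = ∫ x in (0:ℝ)..(2 * Real.pi), ((r1 x * K1 x - r x * K x) + ((1/2) * r x + r x * Real.cos x)) := by
      congr 1; ext x; ring
    rw [e2, intervalIntegral.integral_add (Continuous.intervalIntegrable (by fun_prop) _ _) (Continuous.intervalIntegrable (by fun_prop) _ _),
      intervalIntegral.integral_add (Continuous.intervalIntegrable (by fun_prop) _ _) (Continuous.intervalIntegrable (by fun_prop) _ _),
      intervalIntegral.integral_const_mul, hi, hcs, h0, K10, K12] at e
    linarith
  set s := 4 * r 0 / 3 with hs
  have w := wirt1 (fun x => r x - s * K x) (fun x => r1 x - s * K1 x) (fun x => (hr x).sub ((hKd x).const_mul s)) (by fun_prop)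
    (by simp only [K0, K2, h0]) (by
      rw [intervalIntegral.integral_sub (Continuous.intervalIntegrable (by fun_prop) _ _) (Continuous.intervalIntegrable (by fun_prop) _ _),
        intervalIntegral.integral_const_mul, hi, iK]; simp)
  have e3 : (∫ x in (0:ℝ)..(2 * Real.pi), (r1 x - s * K1 x) ^ 2) - (∫ x in (0:ℝ)..(2 * Real.pi), (r x - s * K x) ^ 2)
      = ((∫ x in (0:ℝ)..(2 * Real.pi), r1 x ^ 2) - ∫ x in (0:ℝ)..(2 * Real.pi), r x ^ 2)
        - 2 * s * (∫ x in (0:ℝ)..(2 * Real.pi), (r1 x * K1 x - r x * K x))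
        + s ^ 2 * ∫ x in (0:ℝ)..(2 * Real.pi), (K1 x ^ 2 - K x ^ 2) := by
    rw [← intervalIntegral.integral_sub (Continuous.intervalIntegrable (by fun_prop) _ _) (Continuous.intervalIntegrable (by fun_prop) _ _),
      ← intervalIntegral.integral_sub (Continuous.intervalIntegrable (by fun_prop) _ _) (Continuous.intervalIntegrable (by fun_prop) _ _),
      ← intervalIntegral.integral_const_mul, ← intervalIntegral.integral_const_mul,
      ← intervalIntegral.integral_sub (Continuous.intervalIntegrable (by fun_prop) _ _) (Continuous.intervalIntegrable (by fun_prop) _ _),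
      ← intervalIntegral.integral_add (Continuous.intervalIntegrable (by fun_prop) _ _) (Continuous.intervalIntegrable (by fun_prop) _ _)]
    congr 1; ext x; ring
  rw [irK, iKK] at e3
  have e4 : - 2 * s * (Real.pi * r 0) + s ^ 2 * (3 * Real.pi / 4) = - (4 * Real.pi * r 0 ^ 2) / 3 := by
    rw [hs]; ring
  linarith

lemma ptwise (r r1 : ℝ → ℝ) (hr : ∀ x, HasDerivAt r (r1 x) x) (hc : Continuous r1)
    (hper : ∀ θ, r (θ + 2 * Real.pi) = r θ) (hper1 : ∀ θ, r1 (θ + 2 * Real.pi) = r1 θ)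
    (hi : ∫ x in (0:ℝ)..(2 * Real.pi), r x = 0)
    (hcs : ∫ x in (0:ℝ)..(2 * Real.pi), r x * Real.cos x = 0)
    (hsn : ∫ x in (0:ℝ)..(2 * Real.pi), r x * Real.sin x = 0) (θ : ℝ) :
    4 * Real.pi * r θ ^ 2 ≤ 3 * ((∫ x in (0:ℝ)..(2 * Real.pi), r1 x ^ 2) - ∫ x in (0:ℝ)..(2 * Real.pi), r x ^ 2) := by
  have hrc : Continuous r := continuous_iff_continuousAt.2 fun x => (hr x).continuousAt
  have sh : ∀ g : ℝ → ℝ, (∀ θ, g (θ + 2 * Real.pi) = g θ) →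
      ∫ x in (0:ℝ)..(2 * Real.pi), g (x + θ) = ∫ x in (0:ℝ)..(2 * Real.pi), g x := by
    intro g hg
    rw [intervalIntegral.integral_comp_add_right, ← shift_int g hg θ]
    congr 1 <;> ring
  have := pt0 (fun x => r (x + θ)) (fun x => r1 (x + θ)) (fun x => (hr (x + θ)).comp_add_const x θ) (by fun_prop)
    (by simp only [zero_add]; rw [add_comm, hper]) (by rw [sh r hper, hi]) (by
      have h := sh (fun y => r y * Real.cos (y - θ)) (by intro y; rw [hper, show y + 2 * Real.pi - θ = y - θ + 2 * Real.pi by ring, Real.cos_add_two_pi])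
      simp only [add_sub_cancel_right] at h
      rw [h]
      have e : ∀ y, r y * Real.cos (y - θ) = Real.cos θ * (r y * Real.cos y) + Real.sin θ * (r y * Real.sin y) := by
        intro y; rw [Real.cos_sub]; ring
      simp_rw [e]
      rw [intervalIntegral.integral_add (Continuous.intervalIntegrable (by fun_prop) _ _) (Continuous.intervalIntegrable (by fun_prop) _ _),
        intervalIntegral.integral_const_mul, intervalIntegral.integral_const_mul, hcs, hsn]
      simp)
  rw [sh (fun x => r x ^ 2) (by intro y; simp [hper]), sh (fun x => r1 x ^ 2) (by intro y; simp [hper1])] at this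
  simpa using this

lemma energy (q q1 q2 q3 : ℝ → ℝ) (hq : ∀ x, HasDerivAt q (q1 x) x) (hq1 : ∀ x, HasDerivAt q1 (q2 x) x)
    (hq2 : ∀ x, HasDerivAt q2 (q3 x) x) (hc : Continuous q3)
    (h0 : q (2 * Real.pi) = q 0) (h1 : q1 (2 * Real.pi) = q1 0) (h2 : q2 (2 * Real.pi) = q2 0)
    (hi : ∫ x in (0:ℝ)..(2 * Real.pi), q x = 0)
    (hcs : ∫ x in (0:ℝ)..(2 * Real.pi), q x * Real.cos x = 0)
    (hsn : ∫ x in (0:ℝ)..(2 * Real.pi), q x * Real.sin x = 0) :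
    3 * ((∫ x in (0:ℝ)..(2 * Real.pi), q1 x ^ 2) - ∫ x in (0:ℝ)..(2 * Real.pi), q x ^ 2)
      ≤ (∫ x in (0:ℝ)..(2 * Real.pi), (q x + q2 x) ^ 2) ∧
    4 * (∫ x in (0:ℝ)..(2 * Real.pi), (q x + q2 x) ^ 2) ≤ ∫ x in (0:ℝ)..(2 * Real.pi), (q1 x + q3 x) ^ 2 := by
  have c0 : Continuous q := continuous_iff_continuousAt.2 fun x => (hq x).continuousAt
  have c1 : Continuous q1 := continuous_iff_continuousAt.2 fun x => (hq1 x).continuousAt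
  have c2 : Continuous q2 := continuous_iff_continuousAt.2 fun x => (hq2 x).continuousAt
  constructor
  · have w := wirt2 q q1 hq c1 h0.symm hi hcs hsn
    have e := intervalIntegral.integral_eq_sub_of_hasDerivAt (a := 0) (b := 2 * Real.pi) (f := fun x => q x * q1 x) (fun x _ => (hq x).mul (hq1 x))
      (Continuous.intervalIntegrable (by fun_prop) _ _)
    rw [h0, h1, sub_self] at e
    have nn : 0 ≤ ∫ x in (0:ℝ)..(2 * Real.pi), (3 * q x + (q x + q2 x)) ^ 2 :=
      intervalIntegral.integral_nonneg (by positivity) fun x _ => sq_nonneg _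
    have e2 : ∫ x in (0:ℝ)..(2 * Real.pi), (3 * q x + (q x + q2 x)) ^ 2
       = ∫ x in (0:ℝ)..(2 * Real.pi), ((15 * q x ^ 2 + (q x + q2 x) ^ 2) + (6 * (q1 x * q1 x + q x * q2 x) - 6 * q1 x ^ 2)) := by
      congr 1; ext x; ring
    rw [e2, intervalIntegral.integral_add (Continuous.intervalIntegrable (by fun_prop) _ _) (Continuous.intervalIntegrable (by fun_prop) _ _),
      intervalIntegral.integral_add (Continuous.intervalIntegrable (by fun_prop) _ _) (Continuous.intervalIntegrable (by fun_prop) _ _),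
      intervalIntegral.integral_sub (Continuous.intervalIntegrable (by fun_prop) _ _) (Continuous.intervalIntegrable (by fun_prop) _ _),
      intervalIntegral.integral_const_mul, intervalIntegral.integral_const_mul, intervalIntegral.integral_const_mul, e] at nn
    linarith
  · refine wirt2 (fun x => q x + q2 x) (fun x => q1 x + q3 x) (fun x => (hq x).add (hq2 x)) (by fun_prop) (by simp only [h0, h2]) ?_ ?_ ?_
    · rw [intervalIntegral.integral_add (Continuous.intervalIntegrable (by fun_prop) _ _) (Continuous.intervalIntegrable (by fun_prop) _ _), hi,
        intervalIntegral.integral_eq_sub_of_hasDerivAt (fun x _ => hq1 x) (Continuous.intervalIntegrable (by fun_prop) _ _), h1]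
      simp
    · rw [intervalIntegral.integral_eq_sub_of_hasDerivAt (f := fun x => q1 x * Real.cos x + q x * Real.sin x) (fun x _ => ?_) (Continuous.intervalIntegrable (by fun_prop) _ _)]
      · simp [h1]
      · refine (((hq1 x).mul (Real.hasDerivAt_cos x)).add ((hq x).mul (Real.hasDerivAt_sin x))).congr_deriv ?_
        ring
    · rw [intervalIntegral.integral_eq_sub_of_hasDerivAt (f := fun x => q1 x * Real.sin x - q x * Real.cos x) (fun x _ => ?_) (Continuous.intervalIntegrable (by fun_prop) _ _)]
      · simp [h0]
      · refine (((hq1 x).mul (Real.hasDerivAt_sin x)).sub ((hq x).mul (Real.hasDerivAt_cos x))).congr_deriv ?_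
        ring

lemma per_deriv (f f1 : ℝ → ℝ) (hf : ∀ x, HasDerivAt f (f1 x) x)
    (hper : ∀ θ, f (θ + 2 * Real.pi) = f θ) : ∀ θ, f1 (θ + 2 * Real.pi) = f1 θ := by
  intro θ
  have h := (hf (θ + 2 * Real.pi)).comp_add_const θ (2 * Real.pi)
  simp_rw [hper] at h
  exact h.unique (hf θ)

lemma dist_iff (x c : EuclideanSpace ℝ (Fin 2)) (R : ℝ) :
    dist x c ≤ R ↔ 0 ≤ R ∧ (x 0 - c 0) ^ 2 + (x 1 - c 1) ^ 2 ≤ R ^ 2 := by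
  rw [EuclideanSpace.dist_eq, Fin.sum_univ_two, Real.sqrt_le_iff, Real.dist_eq, Real.dist_eq, sq_abs, sq_abs]

lemma dir_bound (a b R : ℝ) (h : ∀ θ : ℝ, a * Real.cos θ + b * Real.sin θ ≤ R) :
    0 ≤ R ∧ a ^ 2 + b ^ 2 ≤ R ^ 2 := by
  set z : ℂ := ⟨a, b⟩ with hz
  have h1 : ‖z‖ * Real.cos z.arg = a := Complex.norm_mul_cos_arg z
  have h2 : ‖z‖ * Real.sin z.arg = b := Complex.norm_mul_sin_arg z
  have h3 := h z.arg
  have h4 : ‖z‖ ≤ R := by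
    rw [← h1, ← h2] at h3
    have := Real.sin_sq_add_cos_sq z.arg
    calc ‖z‖ = ‖z‖ * (Real.sin z.arg ^ 2 + Real.cos z.arg ^ 2) := by rw [this, mul_one]
      _ ≤ R := by linarith
  have h0 := norm_nonneg z
  refine ⟨h0.trans h4, ?_⟩
  have : ‖z‖ ^ 2 = a ^ 2 + b ^ 2 := by
    rw [Complex.sq_norm, Complex.normSq_apply]; simp only [hz]; ring
  rw [← this]
  gcongr

lemma radii (p : ℝ → ℝ) (K : Set (EuclideanSpace ℝ (Fin 2)))
    (hK : K = {x | ∀ θ : ℝ, x 0 * Real.cos θ + x 1 * Real.sin θ ≤ p θ})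
    (ρe ρi : ℝ)
    (hρe : ρe = sInf {r : ℝ | 0 ≤ r ∧ ∃ c, K ⊆ Metric.closedBall c r})
    (hρi : ρi = sSup {r : ℝ | 0 ≤ r ∧ ∃ c, Metric.closedBall c r ⊆ K})
    (c d R c' d' r : ℝ) (h1 : ∀ θ, p θ - c * Real.cos θ - d * Real.sin θ ≤ R)
    (h2 : ∀ θ, r ≤ p θ - c' * Real.cos θ - d' * Real.sin θ) (hr : 0 ≤ r) :
    (ρe - ρi) ^ 2 ≤ (R - r) ^ 2 := by
  have cmp : ∀ (c1 c2 : EuclideanSpace ℝ (Fin 2)) (r' R' : ℝ), 0 ≤ r' → Metric.closedBall c1 r' ⊆ Metric.closedBall c2 R' → r' ≤ R' := by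
    intro c1 c2 r' R' hr' hsub
    have a1 := hsub (show !₂[c1 0 + r', c1 1] ∈ Metric.closedBall c1 r' by
      rw [Metric.mem_closedBall, dist_iff]; simp [hr'])
    have a2 := hsub (show !₂[c1 0 - r', c1 1] ∈ Metric.closedBall c1 r' by
      rw [Metric.mem_closedBall, dist_iff]; simp [hr'])
    rw [Metric.mem_closedBall, dist_iff] at a1 a2
    simp at a1 a2
    have b1 : |c1 0 + r' - c2 0| ≤ R' := abs_le_of_sq_le_sq (by nlinarith [sq_nonneg (c1 1 - c2 1)]) a1.1
    have b2 : |c1 0 - r' - c2 0| ≤ R' := abs_le_of_sq_le_sq (by nlinarith [sq_nonneg (c1 1 - c2 1)]) a1.1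
    rw [abs_le] at b1 b2
    linarith
  have hcov : ∀ x ∈ K, x ∈ Metric.closedBall (!₂[c, d] : EuclideanSpace ℝ (Fin 2)) R := by
    intro x hx
    rw [hK] at hx
    rw [Metric.mem_closedBall, dist_iff]
    simp only [Matrix.cons_val_zero, Matrix.cons_val_one]
    apply dir_bound
    intro θ
    have := hx θ
    have := h1 θ
    linarith
  have hin : Metric.closedBall (!₂[c', d'] : EuclideanSpace ℝ (Fin 2)) r ⊆ K := by
    intro x hx
    rw [Metric.mem_closedBall, dist_iff] at hx
    simp only [Matrix.cons_val_zero, Matrix.cons_val_one] at hx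
    rw [hK]
    intro θ
    have hs := Real.sin_sq_add_cos_sq θ
    have : |(x 0 - c') * Real.cos θ + (x 1 - d') * Real.sin θ| ≤ r := by
      apply abs_le_of_sq_le_sq _ hr
      refine le_trans ?_ hx.2
      have : (x 0 - c') ^ 2 + (x 1 - d') ^ 2 = ((x 0 - c') ^ 2 + (x 1 - d') ^ 2) * (Real.sin θ ^ 2 + Real.cos θ ^ 2) := by rw [hs, mul_one]
      rw [this]
      nlinarith [sq_nonneg ((x 0 - c') * Real.sin θ - (x 1 - d') * Real.cos θ)]
    have := (abs_le.1 this).2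
    have := h2 θ
    linarith
  have hR : 0 ≤ R := hr.trans (cmp _ _ r R hr (hin.trans hcov))
  have e1 : ρe ≤ R := by
    rw [hρe]
    exact csInf_le ⟨0, fun y hy => hy.1⟩ ⟨hR, _, hcov⟩
  have e2 : r ≤ ρi := by
    rw [hρi]
    refine le_csSup ⟨R, ?_⟩ ⟨hr, _, hin⟩
    rintro y ⟨hy, c1, hc1⟩
    exact cmp _ _ y R hy (hc1.trans hcov)
  have e3 : ρi ≤ ρe := by
    rw [hρi, hρe]
    refine csSup_le ⟨r, hr, _, hin⟩ ?_
    rintro y ⟨hy, c1, hc1⟩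
    refine le_csInf ⟨R, hR, _, hcov⟩ ?_
    rintro y' ⟨hy', c2, hc2⟩
    exact cmp _ _ y y' hy (hc1.trans hc2)
  apply pow_le_pow_left₀ <;> linarith

lemma final_arith (α δ μ σ η lam ξ ζ L I S E V B X Y Z W D h t : ℝ) (ht : 0 < t)
    (hη : 0 ≤ η) (hξ : 0 ≤ ξ) (hζ : 0 ≤ ζ) (hlam : lam ≤ 0)
    (hc1 : 0 ≤ 2 * α + 4 * t * δ + μ - 4 * ζ)
    (hc2 : 0 ≤ 2 * α + σ - 2 * η - 4 * ζ)
    (hDD : D = 6 * t * α - t * μ + 4 * t * σ + 24 * t * η + 4 * lam + 4 * ξ - 12 * t * ζ)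
    (hD : 0 < D)
    (hE : E = L ^ 2 / (2 * t) - I) (hV : V = S - L ^ 2 / (2 * t)) (hE0 : 0 ≤ E)
    (hEV : 3 * E ≤ V) (hVB : 4 * V ≤ B) (hX : t ^ 2 * X ≤ 2 * t * E) (hY : V ≤ t / 2 * Y) (hZ : 0 ≤ Z)
    (hW : W = α * S + δ * L ^ 2 + μ * (1 / 2 * I) + σ * ((S - I) / 2) + η * B + lam * X + ξ * Y + ζ * Z)
    (hh : 4 * t * h ≤ 3 * E) : h ≤ max 1 (3 / (2 * D)) * W := by
  have hX' : X ≤ 2 * E / t := by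
    rw [le_div_iff₀ ht]; nlinarith
  have hY' : 2 * E / t ≤ Y := by
    rw [div_le_iff₀ ht]; nlinarith
  have l1 : lam * (2 * E / t) ≤ lam * X := mul_le_mul_of_nonpos_left hX' hlam
  have l2 : ξ * (2 * E / t) ≤ ξ * Y := mul_le_mul_of_nonneg_left hY' hξ
  have l3 : η * (4 * V) ≤ η * B := mul_le_mul_of_nonneg_left hVB hη
  have l4 : 0 ≤ ζ * Z := mul_nonneg hζ hZ
  have l5 : 0 ≤ (2 * α + 4 * t * δ + μ - 4 * ζ) * (L ^ 2 / (4 * t)) := by positivity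
  have l6 : 0 ≤ ζ * (L ^ 2 / t) := by positivity
  have l7 : 0 ≤ ζ * V := mul_nonneg hζ (by linarith)
  have l8 : (α + σ / 2 - 2 * ζ + 4 * η) * (3 * E) ≤ (α + σ / 2 - 2 * ζ + 4 * η) * V :=
    mul_le_mul_of_nonneg_left hEV (by linarith)
  have hWl : D * E / (2 * t) ≤ W := by
    have s1 : S = V + L ^ 2 / (2 * t) := by linarith
    have s2 : I = L ^ 2 / (2 * t) - E := by linarith
    have e1 : W = (2 * α + 4 * t * δ + μ - 4 * ζ) * (L ^ 2 / (4 * t)) + ζ * (L ^ 2 / t) + 2 * (ζ * V)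
       + (α + σ / 2 - 2 * ζ + 4 * η) * V + (σ - μ) / 2 * E + (η * B - η * (4 * V)) + lam * X + ξ * Y + ζ * Z := by
      rw [hW, s1, s2]; field_simp; ring
    have e2 : D * E / (2 * t) = (α + σ / 2 - 2 * ζ + 4 * η) * (3 * E) + (σ - μ) / 2 * E + lam * (2 * E / t) + ξ * (2 * E / t) := by
      rw [hDD]; field_simp; ring
    rw [e1, e2]
    linarith
  have hW0 : 0 ≤ W := le_trans (by positivity) hWl
  calc h ≤ 3 * E / (4 * t) := by rw [le_div_iff₀ (by positivity)]; linarith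
    _ = 3 / (2 * D) * (D * E / (2 * t)) := by field_simp; ring
    _ ≤ 3 / (2 * D) * W := by gcongr
    _ ≤ _ := by gcongr; exact le_max_right _ _

set_option maxHeartbeats 2000000 in
theorem stmt3
    (p : ℝ → ℝ)
    (hp : ContDiff ℝ (⊤ : ℕ∞) p)
    (hper : ∀ θ : ℝ, p (θ + 2 * Real.pi) = p θ)
    (ρ : ℝ → ℝ)
    (hρdef : ρ = fun θ => p θ + iteratedDeriv 2 p θ)
    (hρpos : ∀ θ : ℝ, 0 < ρ θ)
    (L A : ℝ)
    (hL : L = ∫ θ in (0:ℝ)..(2 * Real.pi), ρ θ)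
    (hA : A = (1 / 2) * ∫ θ in (0:ℝ)..(2 * Real.pi), (p θ ^ 2 - deriv p θ ^ 2))
    (Atilde : ℝ)
    (hAt : Atilde = (1 / 2) * ∫ θ in (0:ℝ)..(2 * Real.pi), (deriv p θ ^ 2 - iteratedDeriv 2 p θ ^ 2))
    (ρβ : ℝ → ℝ)
    (hρβ : ρβ = fun θ => |deriv p θ + iteratedDeriv 3 p θ|)
    (ρM ρm : ℝ)
    (hρM : ρM = sSup (ρ '' Set.Icc (0:ℝ) (2 * Real.pi)))
    (hρm : ρm = sInf (ρ '' Set.Icc (0:ℝ) (2 * Real.pi)))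
    (K : Set (EuclideanSpace ℝ (Fin 2)))
    (hK : K = {x | ∀ θ : ℝ, x 0 * Real.cos θ + x 1 * Real.sin θ ≤ p θ})
    (ρe ρi : ℝ)
    (hρe : ρe = sInf {r : ℝ | 0 ≤ r ∧ ∃ c, K ⊆ Metric.closedBall c r})
    (hρi : ρi = sSup {r : ℝ | 0 ≤ r ∧ ∃ c, Metric.closedBall c r ⊆ K})
    (cx cy : ℝ)
    (hcx : cx = (1 / Real.pi) * ∫ θ in (0:ℝ)..(2 * Real.pi), p θ * Real.cos θ)
    (hcy : cy = (1 / Real.pi) * ∫ θ in (0:ℝ)..(2 * Real.pi), p θ * Real.sin θ)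
    (pS : ℝ → ℝ)
    (hpS : pS = fun θ => L / (2 * Real.pi) + cx * Real.cos θ + cy * Real.sin θ)
    (α δ μ σ η lam ξ ζ : ℝ)
    (W : ℝ)
    (hW : W = α * (∫ θ in (0:ℝ)..(2 * Real.pi), ρ θ ^ 2) + δ * L ^ 2 + μ * A + σ * |Atilde|
      + η * (∫ θ in (0:ℝ)..(2 * Real.pi), ρβ θ ^ 2) + lam * (ρe - ρi) ^ 2
      + ξ * (ρM - ρm) ^ 2 + ζ * (∫ θ in (0:ℝ)..(2 * Real.pi), (ρ θ)⁻¹))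
    (hη : 0 ≤ η) (hξ : 0 ≤ ξ) (hζ : 0 ≤ ζ) (hlam : lam ≤ 0)
    (hc1 : 0 ≤ 2 * α + 4 * Real.pi * δ + μ - 4 * ζ)
    (hc2 : 0 ≤ 2 * α + σ - 2 * η - 4 * ζ)
    (hD : 0 < (6 * Real.pi * α - Real.pi * μ + 4 * Real.pi * σ + 24 * Real.pi * η + 4 * lam + 4 * ξ - 12 * Real.pi * ζ))
    (h1K : ℝ)
    (hh1 : h1K = ⨆ θ : ℝ, |p θ - pS θ|) :
    h1K ^ 2 ≤ max 1 (3 / (2 * (6 * Real.pi * α - Real.pi * μ + 4 * Real.pi * σ + 24 * Real.pi * η + 4 * lam + 4 * ξ - 12 * Real.pi * ζ))) * W := by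
  have hpi := Real.pi_pos
  have hpi0 : (0:ℝ) ≤ 2 * Real.pi := by positivity
  have hdn : ∀ n : ℕ, ∀ x, HasDerivAt (iteratedDeriv n p) (iteratedDeriv (n + 1) p x) x := by
    intro n x
    rw [iteratedDeriv_succ]
    refine (hp.differentiable_iteratedDeriv n ?_ x).hasDerivAt
    exact_mod_cast WithTop.coe_lt_top n
  have hcn : ∀ n : ℕ, Continuous (iteratedDeriv n p) := fun n =>
    continuous_iff_continuousAt.2 fun x => (hdn n x).continuousAt
  set p1 := deriv p with hp1def
  set p2 := iteratedDeriv 2 p with hp2def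
  set p3 := iteratedDeriv 3 p with hp3def
  have d0 : ∀ x, HasDerivAt p (p1 x) x := by
    intro x; have := hdn 0 x; rwa [iteratedDeriv_zero, zero_add, iteratedDeriv_one] at this
  have d1 : ∀ x, HasDerivAt p1 (p2 x) x := by
    intro x; have := hdn 1 x; rwa [iteratedDeriv_one] at this
  have d2 : ∀ x, HasDerivAt p2 (p3 x) x := hdn 2
  have c0 : Continuous p := by simpa using hcn 0
  have c1 : Continuous p1 := continuous_iff_continuousAt.2 fun x => (d1 x).continuousAt
  have c2 : Continuous p2 := hcn 2
  have c3 : Continuous p3 := hcn 3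
  have hper1 := per_deriv p p1 d0 hper
  have hper2 := per_deriv p1 p2 d1 hper1
  have z0 : p (2 * Real.pi) = p 0 := by simpa using hper 0
  have z1 : p1 (2 * Real.pi) = p1 0 := by simpa using hper1 0
  have z2 : p2 (2 * Real.pi) = p2 0 := by simpa using hper2 0
  have cρ : Continuous ρ := by rw [hρdef]; fun_prop
  have hρx : ∀ x, ρ x = p x + p2 x := fun x => by rw [hρdef]
  have hL' : L = ∫ x in (0:ℝ)..(2 * Real.pi), (p x + p2 x) := by rw [hL, hρdef]
  set I := ∫ x in (0:ℝ)..(2 * Real.pi), (p x ^ 2 - p1 x ^ 2) with hI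
  set S := ∫ x in (0:ℝ)..(2 * Real.pi), ρ x ^ 2 with hS
  set a := L / (2 * Real.pi) with ha
  -- the function q
  set q : ℝ → ℝ := fun x => p x - cx * Real.cos x - cy * Real.sin x - a with hq
  set q1 : ℝ → ℝ := fun x => p1 x + cx * Real.sin x - cy * Real.cos x with hq1
  set q2 : ℝ → ℝ := fun x => p2 x + cx * Real.cos x + cy * Real.sin x with hq2
  set q3 : ℝ → ℝ := fun x => p3 x - cx * Real.sin x + cy * Real.cos x with hq3
  have dq : ∀ x, HasDerivAt q (q1 x) x := by
    intro x
    refine ((((d0 x).sub ((Real.hasDerivAt_cos x).const_mul cx)).sub ((Real.hasDerivAt_sin x).const_mul cy)).sub_const a).congr_deriv ?_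
    simp only [hq1]; ring
  have dq1 : ∀ x, HasDerivAt q1 (q2 x) x := by
    intro x
    refine (((d1 x).add ((Real.hasDerivAt_sin x).const_mul cx)).sub ((Real.hasDerivAt_cos x).const_mul cy)).congr_deriv ?_
    simp only [hq2]; ring
  have dq2 : ∀ x, HasDerivAt q2 (q3 x) x := by
    intro x
    refine (((d2 x).add ((Real.hasDerivAt_cos x).const_mul cx)).add ((Real.hasDerivAt_sin x).const_mul cy)).congr_deriv ?_
    simp only [hq3]; ring
  have cq1 : Continuous q1 := by fun_prop
  have cq3 : Continuous q3 := by fun_prop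
  have ii : ∀ g : ℝ → ℝ, Continuous g → IntervalIntegrable g volume 0 (2 * Real.pi) := fun g hg => hg.intervalIntegrable _ _
  have ip : ∫ x in (0:ℝ)..(2 * Real.pi), p x = L := by
    rw [hL', intervalIntegral.integral_add (ii _ c0) (ii _ c2),
      intervalIntegral.integral_eq_sub_of_hasDerivAt (fun x _ => d1 x) (ii _ c2), z1]
    simp
  have haL : 2 * Real.pi * a = L := by rw [ha]; field_simp
  have qi : ∫ x in (0:ℝ)..(2 * Real.pi), q x = 0 := by
    simp only [hq]
    rw [intervalIntegral.integral_sub (ii _ (by fun_prop)) (ii _ (by fun_prop)),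
      intervalIntegral.integral_sub (ii _ (by fun_prop)) (ii _ (by fun_prop)),
      intervalIntegral.integral_sub (ii _ (by fun_prop)) (ii _ (by fun_prop)), ip,
      intervalIntegral.integral_const_mul, intervalIntegral.integral_const_mul, intervalIntegral.integral_const,
      integral_cos, integral_sin]
    simp
    linarith
  have icc : ∫ x in (0:ℝ)..(2 * Real.pi), Real.cos x ^ 2 = Real.pi := by
    rw [integral_cos_sq]; simp
  have iss : ∫ x in (0:ℝ)..(2 * Real.pi), Real.sin x ^ 2 = Real.pi := by
    rw [integral_sin_sq]; simp
  have isc : ∫ x in (0:ℝ)..(2 * Real.pi), Real.sin x * Real.cos x = 0 := by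
    rw [integral_sin_mul_cos₁]; simp
  have isin : ∫ x in (0:ℝ)..(2 * Real.pi), Real.sin x = 0 := by simp
  have icos : ∫ x in (0:ℝ)..(2 * Real.pi), Real.cos x = 0 := by simp
  have qc : ∫ x in (0:ℝ)..(2 * Real.pi), q x * Real.cos x = 0 := by
    have e : ∀ x, q x * Real.cos x = p x * Real.cos x - cx * Real.cos x ^ 2 - cy * (Real.sin x * Real.cos x) - a * Real.cos x := by
      intro x; simp only [hq]; ring
    simp_rw [e]
    rw [intervalIntegral.integral_sub (ii _ (by fun_prop)) (ii _ (by fun_prop)),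
      intervalIntegral.integral_sub (ii _ (by fun_prop)) (ii _ (by fun_prop)),
      intervalIntegral.integral_sub (ii _ (by fun_prop)) (ii _ (by fun_prop)),
      intervalIntegral.integral_const_mul, intervalIntegral.integral_const_mul, intervalIntegral.integral_const_mul,
      icc, isc, icos, hcx]
    field_simp
    ring
  have qs : ∫ x in (0:ℝ)..(2 * Real.pi), q x * Real.sin x = 0 := by
    have e : ∀ x, q x * Real.sin x = p x * Real.sin x - cx * (Real.sin x * Real.cos x) - cy * Real.sin x ^ 2 - a * Real.sin x := by
      intro x; simp only [hq]; ring
    simp_rw [e]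
    rw [intervalIntegral.integral_sub (ii _ (by fun_prop)) (ii _ (by fun_prop)),
      intervalIntegral.integral_sub (ii _ (by fun_prop)) (ii _ (by fun_prop)),
      intervalIntegral.integral_sub (ii _ (by fun_prop)) (ii _ (by fun_prop)),
      intervalIntegral.integral_const_mul, intervalIntegral.integral_const_mul, intervalIntegral.integral_const_mul,
      iss, isc, isin, hcy]
    field_simp
    ring
  have hqper : ∀ θ, q (θ + 2 * Real.pi) = q θ := by intro θ; simp [hq, hper]
  have hq1per := per_deriv q q1 dq hqper
  obtain ⟨en1, en2⟩ := energy q q1 q2 q3 dq dq1 dq2 cq3 (by simp [hq, z0]) (by simp [hq1, z1]) (by simp [hq2, z2]) qi qc qs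
  have pt := ptwise q q1 dq cq1 hqper hq1per qi qc qs
  set E := (∫ x in (0:ℝ)..(2 * Real.pi), q1 x ^ 2) - ∫ x in (0:ℝ)..(2 * Real.pi), q x ^ 2 with hE
  have hEeq : E = L ^ 2 / (2 * Real.pi) - I := by
    have := quad p p1 p2 d0 d1 c2 hper hper1 cx cy a
    rw [← hL', ← hI] at this
    have h2 : 2 * a * L - 2 * Real.pi * a ^ 2 = L ^ 2 / (2 * Real.pi) := by
      rw [ha]; field_simp; ring
    have h3 : E = -(I - 2 * a * L + 2 * Real.pi * a ^ 2) := by rw [← this, hE]; ring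
    linarith
  have hE0 : 0 ≤ E := by have := wirt1 q q1 dq cq1 (by simp [hq, z0]) qi; rw [hE]; linarith
  set V := ∫ x in (0:ℝ)..(2 * Real.pi), (q x + q2 x) ^ 2 with hV
  have hVeq : V = S - L ^ 2 / (2 * Real.pi) := by
    have e : ∀ x, (q x + q2 x) ^ 2 = ρ x ^ 2 - 2 * a * ρ x + a ^ 2 := by
      intro x; simp only [hq, hq2, hρx]; ring
    rw [hV]
    simp_rw [e]
    rw [intervalIntegral.integral_add (ii _ (by fun_prop)) (ii _ (by fun_prop)),
      intervalIntegral.integral_sub (ii _ (by fun_prop)) (ii _ (by fun_prop)),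
      intervalIntegral.integral_const_mul, intervalIntegral.integral_const, ← hL, ← hS, ha]
    simp
    field_simp
    ring
  have hY : V ≤ Real.pi / 2 * (ρM - ρm) ^ 2 := by
    have cpt : IsCompact (ρ '' Set.Icc (0:ℝ) (2 * Real.pi)) := isCompact_Icc.image cρ
    have hb : ∀ x ∈ Set.Icc (0:ℝ) (2 * Real.pi), ρ x ^ 2 ≤ (ρM + ρm) * ρ x - ρM * ρm := by
      intro x hx
      have b1 : ρ x ≤ ρM := by rw [hρM]; exact le_csSup cpt.bddAbove ⟨x, hx, rfl⟩
      have b2 : ρm ≤ ρ x := by rw [hρm]; exact csInf_le cpt.bddBelow ⟨x, hx, rfl⟩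
      have hm := mul_nonneg (sub_nonneg.2 b1) (sub_nonneg.2 b2)
      linarith
    have := intervalIntegral.integral_mono_on hpi0 (ii _ (by fun_prop)) (ii _ (by fun_prop)) hb
    rw [intervalIntegral.integral_sub (ii _ (by fun_prop)) (ii _ (by fun_prop)),
      intervalIntegral.integral_const_mul, intervalIntegral.integral_const, ← hL, ← hS] at this
    simp only [sub_zero, smul_eq_mul] at this
    have h2 : L ^ 2 / (2 * Real.pi) = 2 * Real.pi * a ^ 2 := by rw [ha]; field_simp
    rw [hVeq, h2]
    rw [← haL] at this
    have hm := mul_nonneg hpi.le (sq_nonneg (ρM + ρm - 2 * a))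
    linarith
  have hSI : |Atilde| = (S - I) / 2 := by
    have e := intervalIntegral.integral_eq_sub_of_hasDerivAt (a := 0) (b := 2 * Real.pi) (f := fun x => p x * p1 x) (fun x _ => (d0 x).mul (d1 x))
      (ii _ (by fun_prop))
    rw [z0, z1, sub_self] at e
    have e2 : ∀ x, p1 x ^ 2 - p2 x ^ 2 = (p x ^ 2 - p1 x ^ 2) - ρ x ^ 2 + 2 * (p1 x * p1 x + p x * p2 x) := by
      intro x; rw [hρx]; ring
    have e3 : Atilde = (I - S) / 2 := by
      rw [hAt]
      simp_rw [e2]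
      rw [intervalIntegral.integral_add (ii _ (by fun_prop)) (ii _ (by fun_prop)),
        intervalIntegral.integral_sub (ii _ (by fun_prop)) (ii _ (by fun_prop)),
        intervalIntegral.integral_const_mul, e, ← hI, ← hS]
      ring
    rw [e3, abs_of_nonpos (by linarith)]
    ring
  have hB : (∫ x in (0:ℝ)..(2 * Real.pi), (q1 x + q3 x) ^ 2) = ∫ x in (0:ℝ)..(2 * Real.pi), ρβ x ^ 2 := by
    congr 1; ext x; rw [hρβ]; simp only [hq1, hq3, sq_abs]; ring
  have hX : Real.pi ^ 2 * (ρe - ρi) ^ 2 ≤ 2 * Real.pi * E := by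
    obtain ⟨c, d, R, c', d', r, b1, b2, b3, b4⟩ := bonnesen p p1 p2 d0 d1 c2 hper hper1 (fun x => by rw [← hρx]; exact hρpos x) L I hL' hI
    have := radii p K hK ρe ρi hρe hρi c d R c' d' r b1 b2 b3
    have h3 : 2 * Real.pi * E = L ^ 2 - 2 * Real.pi * I := by rw [hEeq]; field_simp
    rw [h3]
    exact le_trans (by gcongr) b4
  have hZ : 0 ≤ ∫ θ in (0:ℝ)..(2 * Real.pi), (ρ θ)⁻¹ :=
    intervalIntegral.integral_nonneg hpi0 fun x _ => inv_nonneg.2 (hρpos x).le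
  have hh : 4 * Real.pi * h1K ^ 2 ≤ 3 * E := by
    have hle : h1K ≤ Real.sqrt (3 * E / (4 * Real.pi)) := by
      rw [hh1]
      refine Real.iSup_le (fun θ => ?_) (Real.sqrt_nonneg _)
      apply Real.abs_le_sqrt
      rw [le_div_iff₀ (by positivity)]
      have h1 := pt θ
      have h2 : p θ - pS θ = q θ := by rw [hpS]; simp only [hq]; ring
      rw [h2]
      linarith
    have h0 : 0 ≤ h1K := by rw [hh1]; exact Real.iSup_nonneg fun θ => abs_nonneg _
    have h2 : h1K ^ 2 ≤ 3 * E / (4 * Real.pi) := by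
      calc h1K ^ 2 ≤ Real.sqrt (3 * E / (4 * Real.pi)) ^ 2 := by gcongr
        _ = _ := Real.sq_sqrt (by positivity)
    rw [le_div_iff₀ (by positivity)] at h2
    linarith
  rw [hB] at en2
  rw [hSI, hA] at hW
  exact final_arith α δ μ σ η lam ξ ζ L I S E V _ _ _ _ W _ _ Real.pi hpi hη hξ hζ hlam hc1 hc2 rfl hD hEeq hVeq hE0
    en1 en2 hX hY hZ hW hh
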